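/- Let k₁, k₂ be positive integers and i, j integers. The pairs (i−k₁, j) and (i, j+k₂) lie in the same H-orbit if and only if k₁ = k₂ and either i+j ≡ 0 (mod n) or k₁ ≡ 0 (mod n). -/

import Mathlib

/-- The translation `σₙ : (i,j) ↦ (i+n, j+n)` on segments (pairs of integers). -/
def segSigma (n : ℤ) : Equiv.Perm (ℤ × ℤ) where
  toFun p := (p.1 + n, p.2 + n)
  invFun p := (p.1 - n, p.2 - n)
  left_inv p := by obtain ⟨i, j⟩ := p; simp
  right_inv p := by obtain ⟨i, j⟩ := p; simp

/-- The reflection `θ : (i,j) ↦ (−j, −i)` on segments. -/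
def segTheta : Equiv.Perm (ℤ × ℤ) where
  toFun p := (-p.2, -p.1)
  invFun p := (-p.2, -p.1)
  left_inv p := by obtain ⟨i, j⟩ := p; simp
  right_inv p := by obtain ⟨i, j⟩ := p; simp

/-- The group `H` of symmetries of the set of segments, generated by `σₙ` and `θ`. -/
def segH (n : ℤ) : Subgroup (Equiv.Perm (ℤ × ℤ)) :=
  Subgroup.closure {segSigma n, segTheta}

theorem segSigma_zpow_apply (n m : ℤ) (p : ℤ × ℤ) :
    (segSigma n ^ m) p = (p.1 + m * n, p.2 + m * n) := by
  induction m using Int.induction_on generalizing p with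
  | zero => simp
  | succ m ih =>
    rw [zpow_add_one, Equiv.Perm.mul_apply, ih]
    simp only [segSigma, Equiv.coe_fn_mk, Prod.mk.injEq]
    constructor <;> ring
  | pred m ih =>
    rw [zpow_sub_one, Equiv.Perm.mul_apply, ih]
    simp only [segSigma, Equiv.Perm.inv_def, Equiv.coe_fn_symm_mk, Prod.mk.injEq]
    constructor <;> ring

theorem segSigma_zpow_mem (n m : ℤ) : segSigma n ^ m ∈ segH n :=
  Subgroup.zpow_mem _ (Subgroup.subset_closure (by simp)) m

theorem segTheta_mem (n : ℤ) : segTheta ∈ segH n :=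
  Subgroup.subset_closure (by simp)

/-- Every element of `segH n` acts as a diagonal translation by a multiple of `n`, possibly
composed with the reflection `segTheta`. -/
theorem segH_apply_eq {n : ℤ} {g : Equiv.Perm (ℤ × ℤ)} (hg : g ∈ segH n) :
    ∃ m : ℤ, (∀ p, g p = (p.1 + m * n, p.2 + m * n)) ∨
      (∀ p, g p = (-p.2 + m * n, -p.1 + m * n)) := by
  induction hg using Subgroup.closure_induction with
  | mem x hx =>
    rcases hx with rfl | rfl
    · exact ⟨1, Or.inl fun p => by simp [segSigma]⟩
    · exact ⟨0, Or.inr fun p => by simp [segTheta]⟩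
  | one => exact ⟨0, Or.inl fun p => by simp⟩
  | mul x y _ _ hx hy =>
    obtain ⟨a, ha | ha⟩ := hx <;> obtain ⟨b, hb | hb⟩ := hy
    · exact ⟨a + b, Or.inl fun p => by
        simp only [Equiv.Perm.mul_apply, ha, hb, Prod.mk.injEq]; constructor <;> ring⟩
    · exact ⟨a + b, Or.inr fun p => by
        simp only [Equiv.Perm.mul_apply, ha, hb, Prod.mk.injEq]; constructor <;> ring⟩
    · exact ⟨a - b, Or.inr fun p => by
        simp only [Equiv.Perm.mul_apply, ha, hb, Prod.mk.injEq]; constructor <;> ring⟩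
    · exact ⟨a - b, Or.inl fun p => by
        simp only [Equiv.Perm.mul_apply, ha, hb, Prod.mk.injEq]; constructor <;> ring⟩
  | inv x _ hx =>
    obtain ⟨a, ha | ha⟩ := hx
    · exact ⟨-a, Or.inl fun p => by
        rw [Equiv.Perm.inv_eq_iff_eq, ha, Prod.ext_iff]; constructor <;> ring⟩
    · exact ⟨a, Or.inr fun p => by
        rw [Equiv.Perm.inv_eq_iff_eq, ha, Prod.ext_iff]; constructor <;> ring⟩

/-- For positive integers `k₁, k₂`, the segments `[i−k₁, j]` and `[i, j+k₂]` lie in the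
same `H`-orbit iff `k₁ = k₂` and either `n ∣ i+j` or `n ∣ k₁`. -/
theorem stmt8 (n : ℤ) (hn : 2 ≤ n) (i j k₁ k₂ : ℤ) (hk₁ : 0 < k₁) (hk₂ : 0 < k₂) :
    (∃ g ∈ segH n, g (i - k₁, j) = (i, j + k₂)) ↔
      (k₁ = k₂ ∧ (n ∣ (i + j) ∨ n ∣ k₁)) := by
  constructor
  · rintro ⟨g, hg, h⟩
    obtain ⟨m, hm | hm⟩ := segH_apply_eq hg <;> rw [hm, Prod.mk.injEq] at h <;>
      obtain ⟨h₁, h₂⟩ := h <;> dsimp only at h₁ h₂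
    · exact ⟨by linarith, Or.inr ⟨m, by linarith⟩⟩
    · exact ⟨by linarith, Or.inl ⟨m, by linarith⟩⟩
  · rintro ⟨rfl, ⟨m, hm⟩ | ⟨m, hm⟩⟩
    · refine ⟨segSigma n ^ m * segTheta, mul_mem (segSigma_zpow_mem n m) (segTheta_mem n), ?_⟩
      rw [Equiv.Perm.mul_apply, segSigma_zpow_apply, Prod.mk.injEq]
      simp only [segTheta, Equiv.coe_fn_mk]
      constructor <;> linarith
    · refine ⟨segSigma n ^ m, segSigma_zpow_mem n m, ?_⟩
      rw [segSigma_zpow_apply, Prod.mk.injEq]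
      constructor <;> linarith
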